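/- arXiv:2111.11349 — 2 statements merged into one kernel-verified Lean document; each statement's English description precedes it below -/
import Mathlib

section
/- If Ψ_opt ∈ H_M is a global minimizer of A^u_M, i.e. A^u_M(Ψ_opt) ≤ A^u_M(Ψ) for all Ψ ∈ H_M, then Ψ_opt simultaneously minimizes every level functional: for every ℓ ∈ {0,…,N} and every Ψ ∈ H_M, A^u_{M,ℓ}(Ψ_opt) ≤ A^u_{M,ℓ}(Ψ). -/
open Finset Matrix

/-- The set of sites `S_M = {-M,…,M}^d \ {0}`. -/
noncomputable def SM (d M : ℕ) : Finset (Fin d → ℤ) :=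
  (Fintype.piFinset fun _ : Fin d => Finset.Icc (-(M : ℤ)) M).erase 0

abbrev Site (d M : ℕ) : Type := {x : Fin d → ℤ // x ∈ SM d M}

/-- A configuration is a map `S_M → {0,1}`. -/
abbrev Cfg (d M : ℕ) : Type := Site d M → Bool

/-- `wrap M x` is the unique element of `[-M, M]` congruent to `x` mod `2M+1`. -/
def wrap (M : ℕ) (x : ℤ) : ℤ := (x + M) % (2 * M + 1) - M

/-- `[s]`: coordinatewise wrap into `{-M,…,M}^d`. -/
def wrapVec (d M : ℕ) (s : Fin d → ℤ) : Fin d → ℤ := fun i => wrap M (s i)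

/-- Value of a configuration at an arbitrary point of `ℤ^d` (junk value `false` off `S_M`). -/
noncomputable def get (d M : ℕ) (η : Cfg d M) (s : Fin d → ℤ) : Bool :=
  if h : s ∈ SM d M then η ⟨s, h⟩ else false

/-- The configuration `η^{y+v, y}`, exchanging the values of `η` at `y` and `[y+v]`. -/
noncomputable def swapCfg (d M : ℕ) (η : Cfg d M) (y v : Fin d → ℤ) : Cfg d M := fun s =>
  if (s : Fin d → ℤ) = y then get d M η (wrapVec d M (y + v))
  else if (s : Fin d → ℤ) = wrapVec d M (y + v) then get d M η y
  else η s

/-- The configuration `η^{0, v}` (tagged-particle jump):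
`η^{0,v}_s = η_{[s+v]}` for `s ≠ -v` and `η^{0,v}_{-v} = 0`. -/
noncomputable def jumpCfg (d M : ℕ) (η : Cfg d M) (v : Fin d → ℤ) : Cfg d M := fun s =>
  if (s : Fin d → ℤ) = -v then false
  else get d M η (wrapVec d M ((s : Fin d → ℤ) + v))

/-- Number of occupied sites of a configuration. -/
noncomputable def occ (d M : ℕ) (η : Cfg d M) : ℕ := (univ.filter fun s => η s = true).card

/-- `C_{M,ℓ}`: configurations with exactly `ℓ` occupied sites. -/
noncomputable def CML (d M ℓ : ℕ) : Finset (Cfg d M) := univ.filter fun η => occ d M η = ℓ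

/-- `N = (2M+1)^d - 1`, the cardinality of `S_M`. -/
def NN (d M : ℕ) : ℕ := (2 * M + 1) ^ d - 1

/-- The summand (over configurations `η`) of the functionals `A^u_M` and `A^u_{M,ℓ}`. -/
noncomputable def termA (d M K : ℕ) (v : Fin K → Fin d → ℤ) (p : Fin K → ℝ)
    (u : Fin d → ℝ) (Ψ : Cfg d M → ℝ) (η : Cfg d M) : ℝ :=
  ∑ k : Fin K, p k *
    ((1 - (if get d M η (v k) = true then (1 : ℝ) else 0)) *
        ((∑ i, u i * ((v k i : ℝ))) + Ψ (jumpCfg d M η (v k)) - Ψ η) ^ 2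
      + (1 / 2) * ∑ y ∈ (SM d M).filter (fun y => y + v k ≠ 0),
          (Ψ (swapCfg d M η y (v k)) - Ψ η) ^ 2)

/-- The functional `A^u_M`. -/
noncomputable def AFull (d M K : ℕ) (v : Fin K → Fin d → ℤ) (p : Fin K → ℝ)
    (u : Fin d → ℝ) (Ψ : Cfg d M → ℝ) : ℝ :=
  ∑ η : Cfg d M, termA d M K v p u Ψ η

/-- The level functional `A^u_{M,ℓ}`. -/
noncomputable def AL (d M K : ℕ) (v : Fin K → Fin d → ℤ) (p : Fin K → ℝ)
    (u : Fin d → ℝ) (ℓ : ℕ) (Ψ : Cfg d M → ℝ) : ℝ :=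
  ((CML d M ℓ).card : ℝ)⁻¹ * ∑ η ∈ CML d M ℓ, termA d M K v p u Ψ η

theorem aux_mem_SM {d M : ℕ} {x : Fin d → ℤ} :
    x ∈ SM d M ↔ x ≠ 0 ∧ ∀ i, -(M : ℤ) ≤ x i ∧ x i ≤ M := by
  simp [SM]

theorem aux_wrap_range (M : ℕ) (x : ℤ) : -(M : ℤ) ≤ wrap M x ∧ wrap M x ≤ M := by
  unfold wrap
  have h1 := Int.emod_nonneg (x + M) (show (2 * (M : ℤ) + 1) ≠ 0 by omega)
  have h2 := Int.emod_lt_of_pos (x + M) (show 0 < (2 * (M : ℤ) + 1) by omega)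
  omega

/-- If wraps agree and the difference is small, the arguments agree. -/
theorem aux_wrap_eq {M : ℕ} {x y : ℤ} (h : wrap M x = wrap M y)
    (h1 : -(2 * (M : ℤ)) ≤ x - y) (h2 : x - y ≤ 2 * (M : ℤ)) : x = y := by
  unfold wrap at h
  have h3 : (x + M) % (2 * M + 1) = (y + M) % (2 * (M : ℤ) + 1) := by omega
  have h5 : (2 * (M : ℤ) + 1) ∣ (x + M) - (y + M) := Int.ModEq.dvd (Int.ModEq.symm h3)
  have h6 : (x + M) - (y + M) = 0 := by
    apply Int.eq_zero_of_abs_lt_dvd h5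
    rw [abs_lt]
    constructor <;> omega
  omega

theorem aux_wrap_self {M : ℕ} {x : ℤ} (h1 : -(M : ℤ) ≤ x) (h2 : x ≤ M) : wrap M x = x := by
  unfold wrap
  rw [Int.emod_eq_of_lt] <;> omega

theorem aux_wrapVec_mem {d M : ℕ} {y v : Fin d → ℤ} (hy : y ∈ SM d M) (hv : v ∈ SM d M)
    (h : y + v ≠ 0) : wrapVec d M (y + v) ∈ SM d M := by
  rw [aux_mem_SM] at *
  refine ⟨fun h0 => h ?_, fun i => aux_wrap_range M _⟩
  funext i
  have h1 := congrFun h0 i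
  have hyi := hy.2 i
  have hvi := hv.2 i
  have h2 : wrap M ((y + v) i) = wrap M 0 := by
    rw [aux_wrap_self (x := 0) (by omega) (by omega)]
    exact h1
  have := aux_wrap_eq h2 (by simp only [Pi.add_apply]; omega) (by simp only [Pi.add_apply]; omega)
  simpa using this

theorem aux_occ_comp {d M : ℕ} (η : Cfg d M) (σ : Site d M → Site d M)
    (hσ : Function.Injective σ) : occ d M (fun s => η (σ s)) = occ d M η := by
  have hb : Function.Bijective σ := Finite.injective_iff_bijective.mp hσ
  unfold occ
  exact Finset.card_bijective σ hb (by intro i; simp)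

theorem aux_occ_swap {d M : ℕ} (η : Cfg d M) {y v : Fin d → ℤ} (hy : y ∈ SM d M)
    (hv : v ∈ SM d M) (h : y + v ≠ 0) : occ d M (swapCfg d M η y v) = occ d M η := by
  have hw := aux_wrapVec_mem hy hv h
  rw [← aux_occ_comp η (Equiv.swap ⟨y, hy⟩ ⟨wrapVec d M (y + v), hw⟩) (Equiv.injective _)]
  congr 1
  funext s
  simp only [swapCfg, _root_.get, hy, hw, dite_true, Equiv.swap_apply_def, Subtype.ext_iff]
  split_ifs <;> rfl

theorem aux_occ_jump {d M : ℕ} (η : Cfg d M) {v : Fin d → ℤ}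
    (hv : v ∈ SM d M) (h : get d M η v = false) :
    occ d M (jumpCfg d M η v) = occ d M η := by
  classical
  have hne : ∀ s : Site d M, (s : Fin d → ℤ) ≠ -v → (s : Fin d → ℤ) + v ≠ 0 :=
    fun s hs h0 => hs (eq_neg_of_add_eq_zero_left h0)
  let σ : Site d M → Site d M := fun s =>
    if hs : (s : Fin d → ℤ) = -v then ⟨v, hv⟩
    else ⟨wrapVec d M ((s : Fin d → ℤ) + v), aux_wrapVec_mem s.2 hv (hne s hs)⟩
  have hvb := (aux_mem_SM.mp hv).2
  have key : ∀ s : Site d M, wrapVec d M ((s : Fin d → ℤ) + v) ≠ v := by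
    intro s hs
    have hs2 := aux_mem_SM.mp s.2
    apply hs2.1
    funext i
    have h1 := congrFun hs i
    have h2 : wrap M (s.1 i + v i) = wrap M (v i) := by
      rw [aux_wrap_self (hvb i).1 (hvb i).2]; exact h1
    have h3 := hs2.2 i
    have := aux_wrap_eq h2 (by omega) (by omega)
    simp only [Pi.zero_apply]
    omega
  have hσ : Function.Injective σ := by
    intro s t hst
    simp only [σ] at hst
    split_ifs at hst with h1 h2 h2
    · exact Subtype.ext (h1.trans h2.symm)
    · exact absurd (Subtype.ext_iff.mp hst).symm (key t)
    · exact absurd (Subtype.ext_iff.mp hst) (key s)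
    · have h3 := Subtype.ext_iff.mp hst
      apply Subtype.ext
      funext i
      have h4 : wrap M (s.1 i + v i) = wrap M (t.1 i + v i) := congrFun h3 i
      have h5 := (aux_mem_SM.mp s.2).2 i
      have h6 := (aux_mem_SM.mp t.2).2 i
      have := aux_wrap_eq h4 (by omega) (by omega)
      omega
  rw [← aux_occ_comp η σ hσ]
  congr 1
  funext s
  simp only [jumpCfg, σ]
  split_ifs with hs
  · simpa [_root_.get, hv] using h.symm
  · simp [_root_.get, aux_wrapVec_mem s.2 hv (hne s hs)]

theorem aux_term_congr {d M K : ℕ} {v : Fin K → Fin d → ℤ} (hv : ∀ k, v k ∈ SM d M)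
    (p : Fin K → ℝ) (u : Fin d → ℝ) (Ψ Φ : Cfg d M → ℝ) (η : Cfg d M)
    (h : ∀ ξ, occ d M ξ = occ d M η → Ψ ξ = Φ ξ) :
    termA d M K v p u Ψ η = termA d M K v p u Φ η := by
  unfold termA
  refine Finset.sum_congr rfl fun k _ => ?_
  have hs : ∀ y ∈ (SM d M).filter (fun y => y + v k ≠ 0),
      (Ψ (swapCfg d M η y (v k)) - Ψ η) ^ 2 = (Φ (swapCfg d M η y (v k)) - Φ η) ^ 2 := by
    intro y hy
    rw [Finset.mem_filter] at hy
    rw [h _ (aux_occ_swap η hy.1 (hv k) hy.2), h η rfl]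
  rw [Finset.sum_congr rfl hs]
  by_cases hg : get d M η (v k) = true
  · simp [hg]
  · rw [h _ (aux_occ_jump η (hv k) (by simpa using hg)), h η rfl]

/-- a global minimizer of `A^u_M` simultaneously minimizes every `A^u_{M,ℓ}`. -/
theorem global_minimizer_minimizes_levels (d M K : ℕ) (hd : 1 ≤ d) (hM : 1 ≤ M) (hK : 1 ≤ K)
    (v : Fin K → Fin d → ℤ) (hv : ∀ k, v k ∈ SM d M)
    (p : Fin K → ℝ) (hp : ∀ k, 0 < p k ∧ p k ≤ 1) (u : Fin d → ℝ)
    (Ψopt : Cfg d M → ℝ)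
    (hopt : ∀ Ψ : Cfg d M → ℝ, AFull d M K v p u Ψopt ≤ AFull d M K v p u Ψ) :
    ∀ ℓ ≤ NN d M, ∀ Ψ : Cfg d M → ℝ, AL d M K v p u ℓ Ψopt ≤ AL d M K v p u ℓ Ψ := by
  intro ℓ _ Ψ
  classical
  have h := hopt (fun η => if occ d M η = ℓ then Ψ η else Ψopt η)
  unfold AFull at h
  rw [← Finset.sum_filter_add_sum_filter_not univ (fun η => occ d M η = ℓ),
    ← Finset.sum_filter_add_sum_filter_not univ (fun η => occ d M η = ℓ)
      (termA d M K v p u (fun η => if occ d M η = ℓ then Ψ η else Ψopt η))] at h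
  rw [Finset.sum_congr rfl (fun η hη => aux_term_congr hv p u
      (fun η => if occ d M η = ℓ then Ψ η else Ψopt η) Ψ η
      (fun ξ hξ => if_pos (hξ.trans (Finset.mem_filter.mp hη).2))),
    Finset.sum_congr (s₁ := univ.filter fun η => ¬ occ d M η = ℓ) rfl
      (fun η hη => aux_term_congr hv p u
      (fun η => if occ d M η = ℓ then Ψ η else Ψopt η) Ψopt η
      (fun ξ hξ => if_neg (fun h' => (Finset.mem_filter.mp hη).2 (hξ.symm.trans h'))))] at h
  unfold AL CML
  exact mul_le_mul_of_nonneg_left (le_of_add_le_add_right h) (by positivity)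
end

section
/- For every ℓ ∈ {0,…,N} there exists a symmetric positive semidefinite matrix D ∈ ℝ^{d×d} such that for every u ∈ ℝ^d, u^T D u = 2 · inf_{Ψ ∈ H_M} A^u_{M,ℓ}(Ψ). (This matrix is the discrete self-diffusion matrix 𝔻^M_s(ℓ/N).) -/
open Finset Matrix

def IsSOS {V : Type*} [AddCommGroup V] [Module ℝ V] (f : V → ℝ) : Prop :=
  ∃ l : List (V →ₗ[ℝ] ℝ), ∀ x, f x = (l.map fun g => (g x) ^ 2).sum

namespace IsSOS
variable {V : Type*} [AddCommGroup V] [Module ℝ V]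

lemma sq (g : V →ₗ[ℝ] ℝ) : IsSOS fun x => (g x) ^ 2 := ⟨[g], by simp⟩

lemma zero : IsSOS fun _ : V => (0 : ℝ) := ⟨[], by simp⟩

lemma plus {f g : V → ℝ} (hf : IsSOS f) (hg : IsSOS g) : IsSOS fun x => f x + g x := by
  obtain ⟨l, hl⟩ := hf
  obtain ⟨m, hm⟩ := hg
  exact ⟨l ++ m, fun x => by simp [hl, hm]⟩

lemma scale {f : V → ℝ} (hf : IsSOS f) {c : ℝ} (hc : 0 ≤ c) : IsSOS fun x => c * f x := by
  obtain ⟨l, hl⟩ := hf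
  refine ⟨l.map fun g => Real.sqrt c • g, fun x => ?_⟩
  show c * f x = _
  rw [hl]
  clear hl
  induction l with
  | nil => simp
  | cons a l ih =>
    simp only [List.map_cons, List.sum_cons, mul_add, ih, LinearMap.smul_apply, smul_eq_mul,
      mul_pow, Real.sq_sqrt hc]

lemma fsum {ι : Type*} (s : Finset ι) (f : ι → V → ℝ) (h : ∀ i, IsSOS (f i)) :
    IsSOS fun x => ∑ i ∈ s, f i x := by
  classical
  induction s using Finset.induction_on with
  | empty => simpa using zero
  | insert a s ha ih =>
    simp only [Finset.sum_insert ha]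
    exact (h a).plus ih
end IsSOS

lemma sos_inf (d : ℕ) (W : Type*) [AddCommGroup W] [Module ℝ W]
    (f : (Fin d → ℝ) × W → ℝ) (hf : IsSOS f) :
    ∃ D : Matrix (Fin d) (Fin d) ℝ, D.IsSymm ∧ D.PosSemidef ∧
      ∀ u : Fin d → ℝ, u ⬝ᵥ D.mulVec u = 2 * ⨅ Ψ : W, f (u, Ψ) := by
  obtain ⟨l, hl⟩ := hf
  let n := l.length
  let T : ((Fin d → ℝ) × W) →ₗ[ℝ] EuclideanSpace ℝ (Fin n) :=
    (WithLp.linearEquiv 2 ℝ (Fin n → ℝ)).symm.toLinearMap ∘ₗ LinearMap.pi fun i => l.get i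
  have hT : ∀ x, f x = ‖T x‖ ^ 2 := by
    intro x
    rw [hl, EuclideanSpace.norm_sq_eq]
    have : ∀ i, T x i = l.get i x := fun i => rfl
    simp only [this, Real.norm_eq_abs, sq_abs]
    rw [← Fin.sum_univ_fun_getElem l fun g => (g x) ^ 2]
    rfl
  let R : Submodule ℝ (EuclideanSpace ℝ (Fin n)) := LinearMap.range (T ∘ₗ LinearMap.inr ℝ _ W)
  let P := Rᗮ.starProjection
  have hinf : ∀ u, ⨅ Ψ : W, f (u, Ψ) = ‖P (T (u, 0))‖ ^ 2 := by
    intro u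
    have hsplit : ∀ Ψ, T (u, Ψ) = T (u, 0) + T (0, Ψ) := by
      intro Ψ
      rw [← map_add]; simp
    have hlow : ∀ Ψ, ‖P (T (u, 0))‖ ^ 2 ≤ f (u, Ψ) := by
      intro Ψ
      have h0 : P (T (0, Ψ)) = 0 := by
        apply (Submodule.starProjection_apply_eq_zero_iff _).2
        apply Submodule.le_orthogonal_orthogonal
        exact ⟨Ψ, rfl⟩
      have : P (T (u, 0)) = P (T (u, Ψ)) := by
        rw [hsplit Ψ, map_add, h0, add_zero]
      rw [this, hT]
      gcongr
      exact Submodule.norm_starProjection_apply_le _ _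
    apply le_antisymm
    · have hm : R.starProjection (T (u, 0)) ∈ R := Submodule.starProjection_apply_mem _ _
      obtain ⟨Ψ, hΨ⟩ := hm
      have hΨ' : T (0, Ψ) = R.starProjection (T (u, 0)) := hΨ
      have hb : BddBelow (Set.range fun Ψ : W => f (u, Ψ)) :=
        ⟨_, by rintro _ ⟨Ψ, rfl⟩; exact hlow Ψ⟩
      refine (ciInf_le hb (-Ψ)).trans (le_of_eq ?_)
      have e : T (0, -Ψ) = - T (0, Ψ) := by rw [← map_neg]; simp
      have hP : P (T (u, 0)) = T (u, 0) - R.starProjection (T (u, 0)) :=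
        Submodule.starProjection_orthogonal_val _
      rw [hT, hsplit, e, hΨ', hP, sub_eq_add_neg]
    · exact le_ciInf hlow
  let Wm : (Fin d → ℝ) →ₗ[ℝ] (Fin n → ℝ) :=
    (WithLp.linearEquiv 2 ℝ (Fin n → ℝ)).toLinearMap ∘ₗ P.toLinearMap ∘ₗ T ∘ₗ LinearMap.inl ℝ _ W
  let G := LinearMap.toMatrix' (Real.sqrt 2 • Wm)
  have hps : (Gᵀ * G).PosSemidef := by
    simpa using Matrix.posSemidef_conjTranspose_mul_self G
  refine ⟨Gᵀ * G, ?_, hps, fun u => ?_⟩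
  · simp [Matrix.IsSymm]
  · rw [hinf, ← Matrix.mulVec_mulVec, Matrix.dotProduct_mulVec, Matrix.vecMul_transpose]
    have hG : G *ᵥ u = Real.sqrt 2 • Wm u := by
      simp only [G, LinearMap.toMatrix'_mulVec]
      rfl
    rw [hG, EuclideanSpace.norm_sq_eq]
    have : ∀ i, P (T (u, 0)) i = Wm u i := fun i => rfl
    simp only [this, Real.norm_eq_abs, sq_abs, dotProduct, Pi.smul_apply, smul_eq_mul,
      Finset.mul_sum]
    refine Finset.sum_congr rfl fun i _ => ?_
    have := Real.mul_self_sqrt (show (0:ℝ) ≤ 2 by norm_num)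
    linear_combination (Wm u i) ^ 2 * this

def evCfg (d M : ℕ) (η : Cfg d M) : (Fin d → ℝ) × (Cfg d M → ℝ) →ₗ[ℝ] ℝ :=
  (LinearMap.proj η : (Cfg d M → ℝ) →ₗ[ℝ] ℝ) ∘ₗ LinearMap.snd ℝ (Fin d → ℝ) (Cfg d M → ℝ)

lemma evCfg_apply (d M : ℕ) (η : Cfg d M) (x : (Fin d → ℝ) × (Cfg d M → ℝ)) :
    evCfg d M η x = x.2 η := rfl

lemma AL_sos (d M K : ℕ) (v : Fin K → Fin d → ℤ) (p : Fin K → ℝ) (hp : ∀ k, 0 ≤ p k) (ℓ : ℕ) :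
    IsSOS fun x : (Fin d → ℝ) × (Cfg d M → ℝ) => AL d M K v p x.1 ℓ x.2 := by
  unfold AL
  refine IsSOS.scale (IsSOS.fsum _ _ fun η => ?_) (by positivity)
  unfold termA
  refine IsSOS.fsum _ _ fun k => IsSOS.scale (IsSOS.plus (IsSOS.scale ?_ ?_)
    (IsSOS.scale (IsSOS.fsum _ _ fun y => ?_) (by norm_num))) (hp k)
  · let A : (Fin d → ℝ) →ₗ[ℝ] ℝ :=
      ∑ i, (v k i : ℝ) • (LinearMap.proj i : (Fin d → ℝ) →ₗ[ℝ] ℝ)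
    have hA : ∀ u, A u = ∑ i, u i * (v k i : ℝ) := fun u => by
      simp [A, LinearMap.sum_apply, mul_comm]
    have h := IsSOS.sq (A ∘ₗ LinearMap.fst ℝ (Fin d → ℝ) (Cfg d M → ℝ) +
      evCfg d M (jumpCfg d M η (v k)) - evCfg d M η)
    simpa only [LinearMap.sub_apply, LinearMap.add_apply, LinearMap.comp_apply,
      LinearMap.fst_apply, hA, evCfg_apply] using h
  · split_ifs <;> norm_num
  · have h := IsSOS.sq (evCfg d M (swapCfg d M η y (v k)) - evCfg d M η)
    simpa only [LinearMap.sub_apply, evCfg_apply] using h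

/-- existence of the symmetric positive semidefinite discrete self-diffusion
matrix `𝔻^M_s(ℓ/N)` with `uᵀ D u = 2 inf_Ψ A^u_{M,ℓ}(Ψ)` for all `u`. -/
theorem exists_selfDiffusion_matrix (d M K : ℕ) (hd : 1 ≤ d) (hM : 1 ≤ M) (hK : 1 ≤ K)
    (v : Fin K → Fin d → ℤ) (hv : ∀ k, v k ∈ SM d M)
    (p : Fin K → ℝ) (hp : ∀ k, 0 < p k ∧ p k ≤ 1)
    (ℓ : ℕ) (hℓ : ℓ ≤ NN d M) :
    ∃ D : Matrix (Fin d) (Fin d) ℝ, D.IsSymm ∧ D.PosSemidef ∧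
      ∀ u : Fin d → ℝ,
        u ⬝ᵥ D.mulVec u = 2 * ⨅ Ψ : Cfg d M → ℝ, AL d M K v p u ℓ Ψ := by
  exact sos_inf d (Cfg d M → ℝ) (fun x => AL d M K v p x.1 ℓ x.2)
    (AL_sos d M K v p (fun k => (hp k).1.le) ℓ)
end
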